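/- Let $-\infty\le a<b\le\infty$, let $f:(a,b)\to\mathbb{R}$ be a smooth function with $f>0$, and let $J\subseteq\mathbb{R}$ be a nonempty open interval. Let $M=(a,b)\times J$ be endowed with the Lorentzian metric $g^f=-d\tau^2+f(\tau)^2\,dx^2$. Two points of $M$ are called timelike related if they are joined by a piecewise smooth timelike curve in $M$, i.e. a continuous curve $\gamma:[t_0,t_1]\to M$ with $t_0<t_1$, smooth on each closed piece of a finite subdivision of $[t_0,t_1]$, whose (one-sided) velocities all satisfy $g^f(\gamma',\gamma')<0$ and such that at each breakpoint $t$ the two one-sided velocities lie in the same time cone, i.e. $g^f(\gamma'(t^-),\gamma'(t^+))<0$ (equivalently, $\gamma$ is future-pointing throughout or past-pointing throughout). Let $z=(\tau_0,x_0)$ and $z'=(\tau_0',x_0')$ be distinct points of $M$ with $\tau_0\le\tau_0'$. Then $z$ and $z'$ are timelike related if and only if $$\int_{\tau_0}^{\tau_0'} f(\tau)^{-1}\,d\tau>|x_0'-x_0|;$$ moreover, in this case $z$ and $z'$ are joined by a timelike geodesic of $g^f$ in $M$, i.e. by a smooth curve $(\tau(t),x(t))$ in $M$, defined on a compact interval,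 with $\tau''=-f(\tau)f'(\tau)(x')^2$, $x''=-2\,\frac{f'(\tau)}{f(\tau)}\,\tau'x'$ and $-(\tau')^2+f(\tau)^2(x')^2<0$. -/

import Mathlib

open Set MeasureTheory
open scoped ContDiff

noncomputable section

namespace GRW

/-- The open interval `(a,b)` (with extended-real endpoints) as a subset of `ℝ`. -/
def base (a b : EReal) : Set ℝ := {τ : ℝ | a < (τ : EReal) ∧ (τ : EReal) < b}

/-- The spacetime `M = (a,b) × J`. -/
def spacetime (a b : EReal) (J : Set ℝ) : Set (ℝ × ℝ) := base a b ×ˢ J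

/-- The metric `g^f = -dτ² + f(τ)² dx²` at a point with first coordinate `τ`. -/
def metric (f : ℝ → ℝ) (τ : ℝ) (v w : ℝ × ℝ) : ℝ :=
  -(v.1 * w.1) + (f τ) ^ 2 * (v.2 * w.2)

/-- The velocity at `t` of the curve `(σ, x)` defined on `[t0,t1]`
(one-sided at the endpoints). -/
def velocity (σ x : ℝ → ℝ) (t0 t1 t : ℝ) : ℝ × ℝ :=
  (derivWithin σ (Icc t0 t1) t, derivWithin x (Icc t0 t1) t)

/-- The energy `-(τ')² + f(τ)² (x')²` at `t` of the curve `(σ, x)` defined on `[t0,t1]`. -/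
def energy (f σ x : ℝ → ℝ) (t0 t1 t : ℝ) : ℝ :=
  metric f (σ t) (velocity σ x t0 t1 t) (velocity σ x t0 t1 t)

/-- `t ↦ (σ t, x t)`, `t ∈ [t0,t1]`, is a smooth geodesic of `g^f` in `(a,b) × J`. -/
structure IsGeodesicOn (a b : EReal) (f : ℝ → ℝ) (J : Set ℝ)
    (σ x : ℝ → ℝ) (t0 t1 : ℝ) : Prop where
  lt : t0 < t1
  mem : ∀ t ∈ Icc t0 t1, (σ t, x t) ∈ spacetime a b J
  smooth_base : ContDiffOn ℝ ∞ σ (Icc t0 t1)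
  smooth_fiber : ContDiffOn ℝ ∞ x (Icc t0 t1)
  eq_base : ∀ t ∈ Icc t0 t1,
    derivWithin (derivWithin σ (Icc t0 t1)) (Icc t0 t1) t
      = -(f (σ t) * deriv f (σ t) * (derivWithin x (Icc t0 t1) t) ^ 2)
  eq_fiber : ∀ t ∈ Icc t0 t1,
    derivWithin (derivWithin x (Icc t0 t1)) (Icc t0 t1) t
      = -(2 * (deriv f (σ t) / f (σ t)) * derivWithin σ (Icc t0 t1) t
          * derivWithin x (Icc t0 t1) t)

/-- `z` and `z'` are joined by a timelike geodesic of `g^f` in `(a,b) × J`. -/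
def JoinedByTimelikeGeodesic (a b : EReal) (f : ℝ → ℝ) (J : Set ℝ) (z z' : ℝ × ℝ) : Prop :=
  ∃ (σ x : ℝ → ℝ) (t0 t1 : ℝ), IsGeodesicOn a b f J σ x t0 t1 ∧
    (σ t0, x t0) = z ∧ (σ t1, x t1) = z' ∧ ∀ t ∈ Icc t0 t1, energy f σ x t0 t1 t < 0

/-- `(σ, x)` is a piecewise smooth timelike curve in `(a,b) × J` defined on `[s 0, s (n+1)]`,
with breakpoints `s 1 < ... < s n`. Each piece is smooth up to its endpoints with timelike
(one-sided) velocities, and at each breakpoint the two one-sided velocities lie in the same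
time cone, i.e. their product under `g^f` is negative. -/
structure IsTimelikeCurve (a b : EReal) (f : ℝ → ℝ) (J : Set ℝ)
    (σ x : ℝ → ℝ) (n : ℕ) (s : ℕ → ℝ) : Prop where
  lt : ∀ i ≤ n, s i < s (i + 1)
  mem : ∀ t ∈ Icc (s 0) (s (n + 1)), (σ t, x t) ∈ spacetime a b J
  continuous_base : ContinuousOn σ (Icc (s 0) (s (n + 1)))
  continuous_fiber : ContinuousOn x (Icc (s 0) (s (n + 1)))
  smooth_base : ∀ i ≤ n, ContDiffOn ℝ ∞ σ (Icc (s i) (s (i + 1)))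
  smooth_fiber : ∀ i ≤ n, ContDiffOn ℝ ∞ x (Icc (s i) (s (i + 1)))
  timelike : ∀ i ≤ n, ∀ t ∈ Icc (s i) (s (i + 1)), energy f σ x (s i) (s (i + 1)) t < 0
  same_cone : ∀ i < n, metric f (σ (s (i + 1)))
    (velocity σ x (s i) (s (i + 1)) (s (i + 1)))
    (velocity σ x (s (i + 1)) (s (i + 2)) (s (i + 1))) < 0

/-- `z` and `z'` are timelike related: joined by a piecewise smooth timelike curve. -/
def TimelikeRelated (a b : EReal) (f : ℝ → ℝ) (J : Set ℝ) (z z' : ℝ × ℝ) : Prop :=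
  ∃ (σ x : ℝ → ℝ) (n : ℕ) (s : ℕ → ℝ), IsTimelikeCurve a b f J σ x n s ∧
    (σ (s 0), x (s 0)) = z ∧ (σ (s (n + 1)), x (s (n + 1))) = z'

end GRW

end

namespace GRW

theorem isOpen_base (a b : EReal) : IsOpen (base a b) :=
  (isOpen_lt continuous_const continuous_coe_real_ereal).inter
    (isOpen_lt continuous_coe_real_ereal continuous_const)

theorem ordConnected_base (a b : EReal) : (base a b).OrdConnected :=
  ⟨fun _ hx _ hy _ hz => ⟨hx.1.trans_le (EReal.coe_le_coe_iff.2 hz.1),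
    (EReal.coe_le_coe_iff.2 hz.2).trans_lt hy.2⟩⟩

section Calculus

variable {U : Set ℝ} {h : ℝ → ℝ} {p : ℝ}

theorem hasDerivAt_primitive (hU : IsOpen U) (hUc : U.OrdConnected) (hp : p ∈ U)
    (hh : ContinuousOn h U) {t : ℝ} (ht : t ∈ U) :
    HasDerivAt (fun u => ∫ s in p..u, h s) (h t) t :=
  intervalIntegral.integral_hasDerivAt_right
    ((hh.mono (hUc.uIcc_subset hp ht)).intervalIntegrable)
    (hh.stronglyMeasurableAtFilter hU t ht) (hh.continuousAt (hU.mem_nhds ht))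

theorem contDiffOn_primitive (hU : IsOpen U) (hUc : U.OrdConnected) (hp : p ∈ U)
    (hh : ContDiffOn ℝ ∞ h U) : ContDiffOn ℝ ∞ (fun u => ∫ s in p..u, h s) U := by
  have hd := fun t (ht : t ∈ U) => hasDerivAt_primitive hU hUc hp hh.continuousOn ht
  refine (contDiffOn_infty_iff_deriv_of_isOpen hU).2
    ⟨fun t ht => (hd t ht).differentiableAt.differentiableWithinAt, ?_⟩
  exact hh.congr fun t ht => (hd t ht).deriv

/-- A primitive of a positive smooth function has a smooth inverse. -/
theorem exists_smooth_inverse_primitive (hU : IsOpen U) (hUc : U.OrdConnected) (hp : p ∈ U)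
    (hh : ContDiffOn ℝ ∞ h U) (hpos : ∀ t ∈ U, 0 < h t) :
    ∃ σ : ℝ → ℝ, (∀ u ∈ U, σ (∫ s in p..u, h s) = u) ∧
      ∀ u ∈ U, ContDiffAt ℝ ∞ σ (∫ s in p..u, h s) ∧
        HasDerivAt σ (h u)⁻¹ (∫ s in p..u, h s) := by
  set T : ℝ → ℝ := fun u => ∫ s in p..u, h s with hT
  have hd : ∀ t ∈ U, HasDerivAt T (h t) t :=
    fun t ht => hasDerivAt_primitive hU hUc hp hh.continuousOn ht
  have hTs : ContDiffOn ℝ ∞ T U := contDiffOn_primitive hU hUc hp hh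
  have hmono : StrictMonoOn T U := by
    refine strictMonoOn_of_deriv_pos hUc.convex hTs.continuousOn fun t ht => ?_
    rw [(hd t (interior_subset ht)).deriv]
    exact hpos t (interior_subset ht)
  have hleft : ∀ u ∈ U, Function.invFunOn T U (T u) = u :=
    fun u hu => hmono.injOn.leftInvOn_invFunOn hu
  refine ⟨Function.invFunOn T U, hleft, fun u hu => ?_⟩
  have hne : h u ≠ 0 := (hpos u hu).ne'
  have hTu : ContDiffAt ℝ ∞ T u := hTs.contDiffAt (hU.mem_nhds hu)
  have hfd : HasFDerivAt T
      (ContinuousLinearEquiv.unitsEquivAut ℝ (Units.mk0 (h u) hne) : ℝ →L[ℝ] ℝ) u := hd u hu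
  have hev : ∀ᶠ v in nhds u, Function.invFunOn T U (T v) = v :=
    Filter.eventually_of_mem (hU.mem_nhds hu) hleft
  have huniq := (hTu.hasStrictFDerivAt' hfd (by simp)).localInverse_unique hev
  exact ⟨(hTu.to_localInverse hfd (by simp)).congr_of_eventuallyEq huniq,
    ((hTu.hasStrictDerivAt' (hd u hu) (by simp)).to_local_left_inverse hne hev).hasDerivAt⟩

end Calculus

/-- The speed `τ'` of the geodesic with momentum `f² x' = sin θ` and energy `-cos² θ`. -/
noncomputable def speed (f : ℝ → ℝ) (θ τ : ℝ) : ℝ :=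
  Real.sqrt (Real.cos θ ^ 2 + Real.sin θ ^ 2 / f τ ^ 2)

theorem radicand_pos {f : ℝ → ℝ} {τ : ℝ} (hf : 0 < f τ) (θ : ℝ) :
    0 < Real.cos θ ^ 2 + Real.sin θ ^ 2 / f τ ^ 2 := by
  by_cases hc : Real.cos θ = 0
  · have := Real.sin_sq_add_cos_sq θ
    rw [hc] at this ⊢
    have hs : Real.sin θ ^ 2 = 1 := by linarith
    rw [hs]
    positivity
  · positivity

theorem speed_pos {f : ℝ → ℝ} {τ : ℝ} (hf : 0 < f τ) (θ : ℝ) : 0 < speed f θ τ :=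
  Real.sqrt_pos.2 (radicand_pos hf θ)

theorem speed_sq {f : ℝ → ℝ} {τ : ℝ} (hf : 0 < f τ) (θ : ℝ) :
    speed f θ τ ^ 2 = Real.cos θ ^ 2 + Real.sin θ ^ 2 / f τ ^ 2 :=
  Real.sq_sqrt (radicand_pos hf θ).le

theorem contDiffOn_speed {f : ℝ → ℝ} {U : Set ℝ} (hf : ContDiffOn ℝ ∞ f U)
    (hpos : ∀ τ ∈ U, 0 < f τ) (θ : ℝ) : ContDiffOn ℝ ∞ (speed f θ) U :=
  (contDiffOn_const.add (contDiffOn_const.div (hf.pow 2)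
    fun τ hτ => (pow_pos (hpos τ hτ) 2).ne')).sqrt fun τ hτ => (radicand_pos (hpos τ hτ) θ).ne'

theorem hasDerivAt_speed {f : ℝ → ℝ} {τ f' : ℝ} (hf : HasDerivAt f f' τ) (hpos : 0 < f τ)
    (θ : ℝ) :
    HasDerivAt (speed f θ) (-(Real.sin θ ^ 2 * f' / f τ ^ 3) / speed f θ τ) τ := by
  have h := (((hasDerivAt_const τ (Real.sin θ ^ 2)).div (hf.pow 2)
    (pow_pos hpos 2).ne').const_add (Real.cos θ ^ 2)).sqrt (radicand_pos hpos θ).ne'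
  refine HasDerivAt.congr_deriv h ?_
  have := (speed_pos hpos θ).ne'
  change _ / (2 * speed f θ τ) = _
  simp only [Pi.pow_apply]
  field_simp
  ring

/-- Some angle `θ` realises any coordinate displacement inside the light cone. -/
theorem exists_angle {f : ℝ → ℝ} {p q d : ℝ} (hpq : p ≤ q) (hf : ContinuousOn f (Icc p q))
    (hpos : ∀ τ ∈ Icc p q, 0 < f τ) (hd : |d| < ∫ τ in p..q, (f τ)⁻¹) :
    ∃ θ : ℝ, Real.cos θ ≠ 0 ∧
      ∫ τ in p..q, Real.sin θ / (f τ ^ 2 * speed f θ τ) = d := by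
  set F : ℝ → ℝ := IccExtend hpq ((Icc p q).domRestrict f) with hF
  have hFc : Continuous F := hf.domRestrict.Icc_extend'
  have hFpos : ∀ τ, 0 < F τ := fun τ => hpos _ (projIcc p q hpq τ).2
  have hFe : ∀ τ ∈ Icc p q, F τ = f τ := fun τ hτ => by
    rw [hF, IccExtend_of_mem hpq _ hτ]; rfl
  set Φ : ℝ → ℝ := fun θ => ∫ τ in p..q, Real.sin θ / (F τ ^ 2 * speed F θ τ) with hΦ
  have hΦc : Continuous Φ := by
    refine intervalIntegral.continuous_parametric_intervalIntegral_of_continuous' ?_ p q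
    have h1 : Continuous fun z : ℝ × ℝ => F z.2 := hFc.comp continuous_snd
    have h2 : Continuous fun z : ℝ × ℝ => speed F z.1 z.2 := by
      unfold speed
      refine Continuous.sqrt (((Real.continuous_cos.comp continuous_fst).pow 2).add
        (((Real.continuous_sin.comp continuous_fst).pow 2).div (h1.pow 2)
          fun z => (pow_pos (hFpos z.2) 2).ne'))
    exact (Real.continuous_sin.comp continuous_fst).div ((h1.pow 2).mul h2)
      fun z => (mul_pos (pow_pos (hFpos z.2) 2) (speed_pos (hFpos z.2) z.1)).ne'
  have hΦe : ∀ θ, Φ θ = ∫ τ in p..q, Real.sin θ / (f τ ^ 2 * speed f θ τ) := fun θ => by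
    refine intervalIntegral.integral_congr fun τ hτ => ?_
    rw [uIcc_of_le hpq] at hτ
    simp only [speed, hFe τ hτ]
  have hlight : ∀ θ, Real.cos θ = 0 → Φ θ = Real.sin θ * ∫ τ in p..q, (f τ)⁻¹ := by
    intro θ hθ
    rw [hΦe, ← intervalIntegral.integral_const_mul]
    refine intervalIntegral.integral_congr fun τ hτ => ?_
    rw [uIcc_of_le hpq] at hτ
    have hs : Real.sin θ ^ 2 = 1 := by
      have := Real.sin_sq_add_cos_sq θ
      rw [hθ] at this
      linarith
    have hfp := hpos τ hτ
    have : speed f θ τ = (f τ)⁻¹ := by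
      rw [speed, hθ, hs, show (0 : ℝ) ^ 2 + 1 / f τ ^ 2 = (f τ)⁻¹ ^ 2 by field_simp; ring]
      exact Real.sqrt_sq (inv_pos.2 hfp).le
    simp only [this]
    field_simp
  have hd' := abs_lt.1 hd
  have hmem : d ∈ Icc (Φ (-(Real.pi / 2))) (Φ (Real.pi / 2)) := by
    rw [hlight _ (by simp), hlight _ (by simp)]
    simp only [Real.sin_neg, Real.sin_pi_div_two]
    constructor <;> linarith
  obtain ⟨θ, -, hθ⟩ := intermediate_value_Icc (by linarith [Real.pi_pos]) hΦc.continuousOn hmem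
  refine ⟨θ, fun hc => ?_, (hΦe θ).symm.trans hθ⟩
  have hs := Real.sin_sq_add_cos_sq θ
  rw [hlight θ hc] at hθ
  rw [hc] at hs
  rcases sq_eq_one_iff.1 (by linarith : Real.sin θ ^ 2 = 1) with h | h <;>
    rw [h] at hθ <;> linarith

theorem joinedByTimelikeGeodesic_of_abs_lt {a b : EReal} {f : ℝ → ℝ}
    (hf : ContDiffOn ℝ ∞ f (base a b)) (hfpos : ∀ τ ∈ base a b, 0 < f τ)
    {J : Set ℝ} (hJc : J.OrdConnected) {p x q y : ℝ}
    (hz : (p, x) ∈ spacetime a b J) (hz' : (q, y) ∈ spacetime a b J) (hpq : p ≤ q)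
    (hd : |y - x| < ∫ τ in p..q, (f τ)⁻¹) :
    JoinedByTimelikeGeodesic a b f J (p, x) (q, y) := by
  have hU := isOpen_base a b
  have hUc := ordConnected_base a b
  have hp : p ∈ base a b := hz.1
  have hq : q ∈ base a b := hz'.1
  have hsub : Icc p q ⊆ base a b := hUc.out hp hq
  have hlt : p < q := by
    refine lt_of_le_of_ne hpq fun h => ?_
    rw [← h, intervalIntegral.integral_same] at hd
    exact absurd hd (abs_nonneg _).not_gt
  obtain ⟨θ, hθ, hX⟩ := exists_angle hpq (hf.continuousOn.mono hsub)
    (fun τ hτ => hfpos τ (hsub hτ)) hd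
  have hws := contDiffOn_speed hf hfpos θ
  have hwpos : ∀ τ ∈ base a b, 0 < speed f θ τ := fun τ hτ => speed_pos (hfpos τ hτ) θ
  have hhs : ContDiffOn ℝ ∞ (fun τ => (speed f θ τ)⁻¹) (base a b) :=
    hws.inv fun τ hτ => (hwpos τ hτ).ne'
  have hhpos : ∀ τ ∈ base a b, 0 < (speed f θ τ)⁻¹ := fun τ hτ => inv_pos.2 (hwpos τ hτ)
  obtain ⟨σ, hσT, hσ⟩ := exists_smooth_inverse_primitive hU hUc hp hhs hhpos
  set T : ℝ → ℝ := fun u => ∫ s in p..u, (speed f θ s)⁻¹ with hTdef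
  replace hσT : ∀ u ∈ base a b, σ (T u) = u := hσT
  have hTd : ∀ τ ∈ base a b, HasDerivAt T (speed f θ τ)⁻¹ τ :=
    fun τ hτ => hasDerivAt_primitive hU hUc hp hhs.continuousOn hτ
  have hTmono : StrictMonoOn T (Icc p q) := by
    refine strictMonoOn_of_deriv_pos (convex_Icc p q)
      (fun τ hτ => (hTd τ (hsub hτ)).continuousAt.continuousWithinAt) fun τ hτ => ?_
    rw [(hTd τ (hsub (interior_subset hτ))).deriv]
    exact hhpos τ (hsub (interior_subset hτ))
  have hTc : ContinuousOn T (Icc p q) :=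
    fun τ hτ => (hTd τ (hsub hτ)).continuousAt.continuousWithinAt
  have hTlt : T p < T q := hTmono ⟨le_rfl, hpq⟩ ⟨hpq, le_rfl⟩ hlt
  have hsurj : ∀ t ∈ Icc (T p) (T q), ∃ u ∈ Icc p q, T u = t :=
    fun t ht => intermediate_value_Icc hpq hTc ht
  set ξ : ℝ → ℝ := fun τ => Real.sin θ / (f τ ^ 2 * speed f θ τ) with hξ
  have hξs : ContDiffOn ℝ ∞ ξ (base a b) := contDiffOn_const.div ((hf.pow 2).mul hws)
    fun τ hτ => (mul_pos (pow_pos (hfpos τ hτ) 2) (hwpos τ hτ)).ne'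
  set X : ℝ → ℝ := fun u => ∫ s in p..u, ξ s with hXdef
  have hXs : ContDiffOn ℝ ∞ X (base a b) := contDiffOn_primitive hU hUc hp hξs
  have hXd : ∀ τ ∈ base a b, HasDerivAt X (ξ τ) τ :=
    fun τ hτ => hasDerivAt_primitive hU hUc hp hξs.continuousOn hτ
  have hXp : X p = 0 := intervalIntegral.integral_same
  have hXq : X q = y - x := hX
  have hXc : ContinuousOn X (Icc p q) := hXs.continuousOn.mono hsub
  have hXmem : ∀ u ∈ Icc p q, x + X u ∈ J := by
    intro u hu
    have hpl : p ∈ Icc p q := ⟨le_rfl, hpq⟩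
    have hql : q ∈ Icc p q := ⟨hpq, le_rfl⟩
    refine hJc.uIcc_subset hz.2 hz'.2 ?_
    have hden : ∀ τ ∈ interior (Icc p q), 0 < f τ ^ 2 * speed f θ τ := fun τ hτ =>
      mul_pos (pow_pos (hfpos τ (hsub (interior_subset hτ))) 2)
        (hwpos τ (hsub (interior_subset hτ)))
    have hXdiff : DifferentiableOn ℝ X (interior (Icc p q)) := fun τ hτ =>
      (hXd τ (hsub (interior_subset hτ))).differentiableAt.differentiableWithinAt
    rcases le_total 0 (Real.sin θ) with h | h
    · have hm : MonotoneOn X (Icc p q) := by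
        refine monotoneOn_of_deriv_nonneg (convex_Icc p q) hXc hXdiff fun τ hτ => ?_
        rw [(hXd τ (hsub (interior_subset hτ))).deriv]
        exact div_nonneg h (hden τ hτ).le
      have h1 := hm hpl hu hu.1
      have h2 := hm hu hql hu.2
      exact mem_uIcc.2 (Or.inl ⟨by linarith, by linarith⟩)
    · have hm : AntitoneOn X (Icc p q) := by
        refine antitoneOn_of_deriv_nonpos (convex_Icc p q) hXc hXdiff fun τ hτ => ?_
        rw [(hXd τ (hsub (interior_subset hτ))).deriv]
        exact div_nonpos_of_nonpos_of_nonneg h (hden τ hτ).le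
      have h1 := hm hpl hu hu.1
      have h2 := hm hu hql hu.2
      exact mem_uIcc.2 (Or.inr ⟨by linarith, by linarith⟩)
  have hI : UniqueDiffOn ℝ (Icc (T p) (T q)) := uniqueDiffOn_Icc hTlt
  have hσd : ∀ u ∈ base a b, HasDerivAt σ (speed f θ u) (T u) := fun u hu => by
    simpa using (hσ u hu).2
  have hxd : ∀ u ∈ base a b,
      HasDerivAt (fun t => x + X (σ t)) (Real.sin θ / f u ^ 2) (T u) := fun u hu => by
    have h := ((hXd (σ (T u)) (by rwa [hσT u hu])).comp (T u) (hσd u hu)).const_add x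
    refine HasDerivAt.congr_deriv h ?_
    rw [hσT u hu, hξ]
    have := (hfpos u hu).ne'
    have := (hwpos u hu).ne'
    field_simp
  have hσ1 : ∀ t ∈ Icc (T p) (T q),
      derivWithin σ (Icc (T p) (T q)) t = speed f θ (σ t) := by
    rintro t ht
    obtain ⟨u, hu, rfl⟩ := hsurj t ht
    rw [hσT u (hsub hu)]
    exact (hσd u (hsub hu)).hasDerivWithinAt.derivWithin (hI _ ht)
  have hx1 : ∀ t ∈ Icc (T p) (T q),
      derivWithin (fun t => x + X (σ t)) (Icc (T p) (T q)) t = Real.sin θ / f (σ t) ^ 2 := by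
    rintro t ht
    obtain ⟨u, hu, rfl⟩ := hsurj t ht
    rw [hσT u (hsub hu)]
    exact (hxd u (hsub hu)).hasDerivWithinAt.derivWithin (hI _ ht)
  have hfd : ∀ u ∈ base a b, HasDerivAt f (deriv f u) u := fun u hu =>
    ((hf.contDiffAt (hU.mem_nhds hu)).differentiableAt (by simp)).hasDerivAt
  refine ⟨σ, fun t => x + X (σ t), T p, T q, ⟨hTlt, ?_, ?_, ?_, ?_, ?_⟩, ?_, ?_, ?_⟩
  · intro t ht
    obtain ⟨u, hu, rfl⟩ := hsurj t ht
    rw [hσT u (hsub hu)]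
    exact ⟨hsub hu, hXmem u hu⟩
  · intro t ht
    obtain ⟨u, hu, rfl⟩ := hsurj t ht
    exact (hσ u (hsub hu)).1.contDiffWithinAt
  · intro t ht
    obtain ⟨u, hu, rfl⟩ := hsurj t ht
    have hXu : ContDiffAt ℝ ∞ X (σ (T u)) := by
      rw [hσT u (hsub hu)]
      exact hXs.contDiffAt (hU.mem_nhds (hsub hu))
    exact (contDiffAt_const.add (hXu.comp (T u) (hσ u (hsub hu)).1)).contDiffWithinAt
  · intro t ht
    rw [derivWithin_congr hσ1 (hσ1 t ht), hx1 t ht]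
    obtain ⟨u, hu, rfl⟩ := hsurj t ht
    have hub := hsub hu
    have hw := hasDerivAt_speed (hfd u hub) (hfpos u hub) θ
    have h := HasDerivAt.comp (T u) (by rwa [hσT u hub]) (hσd u hub)
    refine ((h.hasDerivWithinAt (s := Icc (T p) (T q))).derivWithin (hI _ ht)).trans ?_
    rw [hσT u hub]
    have := (hfpos u hub).ne'
    have := (hwpos u hub).ne'
    field_simp
  · intro t ht
    rw [derivWithin_congr hx1 (hx1 t ht), hx1 t ht, hσ1 t ht]
    obtain ⟨u, hu, rfl⟩ := hsurj t ht
    have hub := hsub hu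
    have hne := (hfpos u hub).ne'
    have hf2 := (hasDerivAt_const u (Real.sin θ)).div ((hfd u hub).pow 2) (pow_ne_zero 2 hne)
    have h := HasDerivAt.comp (T u) (by rwa [hσT u hub]) (hσd u hub)
    refine ((h.hasDerivWithinAt (s := Icc (T p) (T q))).derivWithin (hI _ ht)).trans ?_
    rw [hσT u hub]
    simp only [Pi.pow_apply]
    field_simp
    ring
  · simp [hσT p hp, hXp]
  · simp [hσT q hq, hXq]
  · intro t ht
    have hu : σ t ∈ base a b := by
      obtain ⟨u, hu, rfl⟩ := hsurj t ht
      rw [hσT u (hsub hu)]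
      exact hsub hu
    simp only [energy, velocity, metric, hσ1 t ht, hx1 t ht]
    have hne := (hfpos _ hu).ne'
    have hsq := speed_sq (hfpos _ hu) θ
    have : -(speed f θ (σ t) * speed f θ (σ t)) +
        f (σ t) ^ 2 * (Real.sin θ / f (σ t) ^ 2 * (Real.sin θ / f (σ t) ^ 2)) =
        -Real.cos θ ^ 2 := by
      rw [← pow_two, hsq]
      field_simp
      ring
    rw [this]
    have : 0 < Real.cos θ ^ 2 := by positivity
    linarith

theorem JoinedByTimelikeGeodesic.timelikeRelated {a b : EReal} {f : ℝ → ℝ} {J : Set ℝ}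
    {z z' : ℝ × ℝ} (h : JoinedByTimelikeGeodesic a b f J z z') :
    TimelikeRelated a b f J z z' := by
  obtain ⟨σ, x, t0, t1, hg, h0, h1, hE⟩ := h
  refine ⟨σ, x, 0, fun i => if i = 0 then t0 else t1, ⟨?_, ?_, ?_, ?_, ?_, ?_, ?_, ?_⟩, h0, h1⟩
  · intro i hi
    obtain rfl := Nat.le_zero.1 hi
    exact hg.lt
  · exact hg.mem
  · exact hg.smooth_base.continuousOn
  · exact hg.smooth_fiber.continuousOn
  · intro i hi
    obtain rfl := Nat.le_zero.1 hi
    exact hg.smooth_base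
  · intro i hi
    obtain rfl := Nat.le_zero.1 hi
    exact hg.smooth_fiber
  · intro i hi
    obtain rfl := Nat.le_zero.1 hi
    exact hE
  · exact fun i hi => absurd hi (Nat.not_lt_zero i)

theorem abs_mul_lt_abs_of_metric_neg {f : ℝ → ℝ} {τ : ℝ} {v : ℝ × ℝ}
    (hv : metric f τ v v < 0) : |f τ * v.2| < |v.1| := by
  refine sq_lt_sq.1 ?_
  simp only [metric] at hv
  nlinarith

/-- Timelike vectors with negative product point to the same side. -/
theorem fst_mul_fst_pos_of_metric_neg {f : ℝ → ℝ} {τ : ℝ} {v w : ℝ × ℝ}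
    (hv : metric f τ v v < 0) (hw : metric f τ w w < 0) (hvw : metric f τ v w < 0) :
    0 < v.1 * w.1 := by
  by_contra! hle
  have h := mul_lt_mul'' (abs_mul_lt_abs_of_metric_neg hv) (abs_mul_lt_abs_of_metric_neg hw)
    (abs_nonneg _) (abs_nonneg _)
  rw [← abs_mul, ← abs_mul, abs_of_nonpos hle] at h
  have h' := neg_abs_le (f τ * v.2 * (f τ * w.2))
  simp only [metric] at hvw
  nlinarith

/-- Along a timelike piece whose initial velocity has `ε τ' > 0`, where `ε = ±1`, this persists,
and `F ∘ τ` varies by more than the fibre coordinate for every primitive `F` of `1 / f`. -/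
theorem timelike_piece {f F σ x : ℝ → ℝ} {U : Set ℝ} (hfpos : ∀ τ ∈ U, 0 < f τ)
    (hF : ∀ τ ∈ U, HasDerivAt F (f τ)⁻¹ τ) {t0 t1 ε : ℝ} (ht : t0 < t1)
    (hσ : ContDiffOn ℝ ∞ σ (Icc t0 t1)) (hx : ContDiffOn ℝ ∞ x (Icc t0 t1))
    (hmem : ∀ t ∈ Icc t0 t1, σ t ∈ U)
    (hE : ∀ t ∈ Icc t0 t1, energy f σ x t0 t1 t < 0)
    (hε : |ε| = 1) (h0 : 0 < ε * derivWithin σ (Icc t0 t1) t0) :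
    (∀ t ∈ Icc t0 t1, 0 < ε * derivWithin σ (Icc t0 t1) t) ∧
      |x t1 - x t0| < ε * (F (σ t1) - F (σ t0)) := by
  set I := Icc t0 t1 with hI
  have hIu : UniqueDiffOn ℝ I := uniqueDiffOn_Icc ht
  have hl : t0 ∈ I := ⟨le_rfl, ht.le⟩
  have hr : t1 ∈ I := ⟨ht.le, le_rfl⟩
  have hcone : ∀ t ∈ I, |f (σ t) * derivWithin x I t| < |derivWithin σ I t| :=
    fun t h => abs_mul_lt_abs_of_metric_neg (hE t h)
  have hsign : ∀ t ∈ I, 0 < ε * derivWithin σ I t := by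
    intro t h
    by_contra! hle
    have hc : ContinuousOn (fun s => ε * derivWithin σ I s) I :=
      continuousOn_const.mul (hσ.continuousOn_derivWithin hIu (by simp))
    obtain ⟨s, hs, hs0⟩ := isPreconnected_Icc.intermediate_value h hl hc ⟨hle, h0.le⟩
    have hε0 : ε ≠ 0 := by
      rintro rfl
      simp at hε
    have hz := (mul_eq_zero.1 hs0).resolve_left hε0
    have := hcone s hs
    rw [hz, abs_zero] at this
    exact absurd this (abs_nonneg _).not_gt
  refine ⟨hsign, ?_⟩
  have key : ∀ δ : ℝ, |δ| = 1 → δ * (x t1 - x t0) < ε * (F (σ t1) - F (σ t0)) := by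
    intro δ hδ
    set φ : ℝ → ℝ := fun t => ε * F (σ t) - δ * x t with hφ
    have hφd : ∀ t ∈ I, HasDerivWithinAt φ
        (ε * ((f (σ t))⁻¹ * derivWithin σ I t) - δ * derivWithin x I t) I t := fun t h =>
      (((hF _ (hmem t h)).comp_hasDerivWithinAt t
        ((hσ.differentiableOn (by simp)) t h).hasDerivWithinAt).const_mul ε).sub
        (((hx.differentiableOn (by simp)) t h).hasDerivWithinAt.const_mul δ)
    have hφm : StrictMonoOn φ I := by
      refine strictMonoOn_of_deriv_pos (convex_Icc _ _)
        (fun t h => (hφd t h).continuousWithinAt) fun t h => ?_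
      have htI := interior_subset h
      rw [((hφd t htI).hasDerivAt (mem_interior_iff_mem_nhds.1 h)).deriv]
      have hfp := hfpos _ (hmem t htI)
      have h1 := hcone t htI
      have h2 : ε * derivWithin σ I t = |derivWithin σ I t| := by
        rw [← abs_of_pos (hsign t htI), abs_mul, hε, one_mul]
      have h3 : δ * (f (σ t) * derivWithin x I t) ≤ |f (σ t) * derivWithin x I t| := by
        refine (le_abs_self _).trans ?_
        rw [abs_mul, hδ, one_mul]
      have h4 : ε * ((f (σ t))⁻¹ * derivWithin σ I t) - δ * derivWithin x I t =
          (f (σ t))⁻¹ * (ε * derivWithin σ I t - δ * (f (σ t) * derivWithin x I t)) := by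
        field_simp
      rw [h4]
      exact mul_pos (inv_pos.2 hfp) (by linarith)
    have := hφm hl hr ht
    simp only [hφ] at this
    linarith
  have h1 := key 1 (by simp)
  have h2 := key (-1) (by simp)
  exact abs_lt.2 ⟨by linarith, by linarith⟩

theorem IsTimelikeCurve.mem_base {a b : EReal} {f : ℝ → ℝ} {J : Set ℝ} {σ x : ℝ → ℝ} {n : ℕ}
    {s : ℕ → ℝ} (h : IsTimelikeCurve a b f J σ x n s) {i : ℕ} (hi : i ≤ n) {t : ℝ}
    (ht : t ∈ Icc (s i) (s (i + 1))) : σ t ∈ base a b := by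
  have hm : MonotoneOn s (Icc 0 (n + 1)) :=
    monotoneOn_of_le_succ ordConnected_Icc fun j _ _ hj => (h.lt j (by
      simp only [Nat.succ_eq_succ, mem_Icc] at hj; omega)).le
  exact (h.mem t ⟨(hm ⟨le_rfl, by omega⟩ ⟨by omega, by omega⟩ (Nat.zero_le i)).trans ht.1,
    ht.2.trans (hm ⟨by omega, by omega⟩ ⟨by omega, le_rfl⟩ (by omega))⟩).1

theorem TimelikeRelated.abs_lt_integral {a b : EReal} {f : ℝ → ℝ}
    (hf : ContDiffOn ℝ ∞ f (base a b)) (hfpos : ∀ τ ∈ base a b, 0 < f τ)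
    {J : Set ℝ} {p x₀ q y : ℝ} (hp : p ∈ base a b) (hq : q ∈ base a b) (hpq : p ≤ q)
    (h : TimelikeRelated a b f J (p, x₀) (q, y)) :
    |y - x₀| < ∫ τ in p..q, (f τ)⁻¹ := by
  obtain ⟨σ, x, n, s, hc, h0, h1⟩ := h
  obtain ⟨rfl, rfl⟩ := Prod.mk.inj h0
  obtain ⟨rfl, rfl⟩ := Prod.mk.inj h1
  have hic : ContinuousOn (fun τ => (f τ)⁻¹) (base a b) :=
    hf.continuousOn.inv₀ fun τ hτ => (hfpos τ hτ).ne'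
  set F : ℝ → ℝ := fun u => ∫ τ in σ (s 0)..u, (f τ)⁻¹ with hFdef
  have hF : ∀ τ ∈ base a b, HasDerivAt F (f τ)⁻¹ τ := fun τ hτ =>
    hasDerivAt_primitive (isOpen_base a b) (ordConnected_base a b) hp hic hτ
  have hF0 : F (σ (s 0)) = 0 := intervalIntegral.integral_same
  have hFq : 0 ≤ F (σ (s (n + 1))) :=
    intervalIntegral.integral_nonneg hpq fun τ hτ =>
      (inv_pos.2 (hfpos τ ((ordConnected_base a b).out hp hq hτ))).le
  have hleft : ∀ i ≤ n, s i ∈ Icc (s i) (s (i + 1)) := fun i hi => ⟨le_rfl, (hc.lt i hi).le⟩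
  have hright : ∀ i ≤ n, s (i + 1) ∈ Icc (s i) (s (i + 1)) :=
    fun i hi => ⟨(hc.lt i hi).le, le_rfl⟩
  set v : ℝ := derivWithin σ (Icc (s 0) (s 1)) (s 0) with hv
  have hv0 : v ≠ 0 := by
    intro h
    have := abs_mul_lt_abs_of_metric_neg (hc.timelike 0 (Nat.zero_le n) _ (hleft 0 (Nat.zero_le n)))
    rw [show (velocity σ x (s 0) (s (0 + 1)) (s 0)).1 = 0 from h, abs_zero] at this
    exact absurd this (abs_nonneg _).not_gt
  obtain ⟨ε, hε, hεv⟩ : ∃ ε : ℝ, |ε| = 1 ∧ 0 < ε * v := by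
    rcases lt_or_gt_of_ne hv0 with h | h
    · exact ⟨-1, by simp, by linarith⟩
    · exact ⟨1, by simp, by linarith⟩
  have hpiece : ∀ i ≤ n, 0 < ε * derivWithin σ (Icc (s i) (s (i + 1))) (s i) →
      (∀ t ∈ Icc (s i) (s (i + 1)), 0 < ε * derivWithin σ (Icc (s i) (s (i + 1))) t) ∧
        |x (s (i + 1)) - x (s i)| < ε * (F (σ (s (i + 1))) - F (σ (s i))) :=
    fun i hi h => timelike_piece hfpos hF (hc.lt i hi) (hc.smooth_base i hi)
      (hc.smooth_fiber i hi) (fun t ht => hc.mem_base hi ht) (hc.timelike i hi) hε h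
  have hdir : ∀ i ≤ n, 0 < ε * derivWithin σ (Icc (s i) (s (i + 1))) (s i) := by
    intro i
    induction i with
    | zero => exact fun _ => hεv
    | succ i ih =>
      intro hi
      have hi' : i ≤ n := by omega
      have hend := (hpiece i hi' (ih hi')).1 _ (hright i hi')
      have hprod := fst_mul_fst_pos_of_metric_neg (hc.timelike i hi' _ (hright i hi'))
        (hc.timelike (i + 1) hi _ (hleft (i + 1) hi)) (hc.same_cone i (by omega))
      simp only [velocity] at hprod
      have hsq : ε * ε = 1 := by rw [← abs_mul_abs_self, hε, one_mul]
      refine pos_of_mul_pos_right ?_ hend.le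
      calc (0 : ℝ) < _ := hprod
        _ = (ε * ε) * _ := by rw [hsq, one_mul]
        _ = _ := by ring
  have hsum : ∀ i ≤ n, |x (s (i + 1)) - x (s 0)| < ε * (F (σ (s (i + 1))) - F (σ (s 0))) := by
    intro i
    induction i with
    | zero => exact fun h => (hpiece 0 h (hdir 0 h)).2
    | succ i ih =>
      intro hi
      have h1 := ih (by omega)
      have h2 := (hpiece (i + 1) hi (hdir _ hi)).2
      have h3 := abs_sub_le (x (s (i + 1 + 1))) (x (s (i + 1))) (x (s 0))
      linarith
  have hfin := hsum n le_rfl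
  rw [hF0, sub_zero] at hfin
  refine hfin.trans_le ((le_abs_self _).trans ?_)
  rw [abs_mul, hε, one_mul, abs_of_nonneg hFq]

end GRW

theorem timelike_related_iff
    (a b : EReal) (hab : a < b) (f : ℝ → ℝ)
    (hf : ContDiffOn ℝ ∞ f (GRW.base a b)) (hfpos : ∀ τ ∈ GRW.base a b, 0 < f τ)
    (J : Set ℝ) (hJne : J.Nonempty) (hJo : IsOpen J) (hJc : J.OrdConnected)
    (τ0 x0 τ0' x0' : ℝ)
    (hz : (τ0, x0) ∈ GRW.spacetime a b J) (hz' : (τ0', x0') ∈ GRW.spacetime a b J)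
    (hne : (τ0, x0) ≠ (τ0', x0')) (hle : τ0 ≤ τ0') :
    (GRW.TimelikeRelated a b f J (τ0, x0) (τ0', x0') ↔
      (∫ τ in τ0..τ0', (f τ)⁻¹) > |x0' - x0|) ∧
    (GRW.TimelikeRelated a b f J (τ0, x0) (τ0', x0') →
      GRW.JoinedByTimelikeGeodesic a b f J (τ0, x0) (τ0', x0')) := by
  have hcone := fun h : GRW.TimelikeRelated a b f J (τ0, x0) (τ0', x0') =>
    h.abs_lt_integral hf hfpos hz.1 hz'.1 hle
  have hgeo := GRW.joinedByTimelikeGeodesic_of_abs_lt hf hfpos hJc hz hz' hle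
  exact ⟨⟨hcone, fun h => (hgeo h).timelikeRelated⟩, fun h => hgeo (hcone h)⟩
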